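/- arXiv:0708.1481 — 2 statements merged into one kernel-verified Lean document; each statement's English description precedes it below -/
import Mathlib

section
/- Let K be a field, m < n, J ⊂ S' = K[x_1,...,x_m] a monomial ideal, S = K[x_1,...,x_n], and I = JS the extension of J to S. Then for any variable x_k with m < k ≤ n one has sdepth(S/(I,x_k)) = sdepth(S/I) − 1. -/
/-!
STATEMENT 2 (Lemma 1.2): Let `K` be a field, `m < n`, `J ⊂ S' = K[x_1,…,x_m]` a
monomial ideal, `S = K[x_1,…,x_n]`, and `I = JS` the extension of `J` to `S`.
Then for any variable `x_k` with `m < k ≤ n` one has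
`sdepth(S/(I,x_k)) = sdepth(S/I) − 1`, stated as `sdepth(S/(I,x_k)) + 1 = sdepth(S/I)`.
(In `Fin n` indexing, the variables `x_{m+1},…,x_n` are `X k` with `m ≤ k.val < n`.)
-/

open MvPolynomial

noncomputable section

variable (K : Type*) [Field K] {n : ℕ}
open MvPolynomial

noncomputable section

variable (K : Type*) [Field K] {n : ℕ}

/-- A monomial ideal: an ideal generated by monomials. -/
def IsMonomialIdeal (I : Ideal (MvPolynomial (Fin n) K)) : Prop :=
  ∃ A : Set (Fin n →₀ ℕ),
    I = Ideal.span ((fun d => (monomial d (1 : K) : MvPolynomial (Fin n) K)) '' A)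

/-- The Stanley space `u·K[Z]`: the `K`-subspace of `K[x_1,…,x_n]` spanned by all
monomials `u·v` where `v` is a monomial in the variables of `Z`. -/
def stanleySpace (u : Fin n →₀ ℕ) (Z : Finset (Fin n)) : Submodule K (MvPolynomial (Fin n) K) :=
  Submodule.span K
    ((fun e => (monomial (u + e) (1 : K) : MvPolynomial (Fin n) K)) ''
      {e : Fin n →₀ ℕ | ∀ i ∉ Z, e i = 0})

/-- `I^c`: the `K`-subspace of `S` spanned by all monomials not belonging to `I`. -/
def monomialComplement (I : Ideal (MvPolynomial (Fin n) K)) :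
    Submodule K (MvPolynomial (Fin n) K) :=
  Submodule.span K
    {f : MvPolynomial (Fin n) K | ∃ d : Fin n →₀ ℕ, f = monomial d (1 : K) ∧ f ∉ I}

/-- A Stanley decomposition of `S/I`: a presentation of `I^c` as a finite direct
sum of Stanley spaces. -/
structure StanleyDecomposition (I : Ideal (MvPolynomial (Fin n) K)) where
  r : ℕ
  u : Fin r → (Fin n →₀ ℕ)
  Z : Fin r → Finset (Fin n)
  indep : iSupIndep fun i => stanleySpace K (u i) (Z i)
  sup_eq : ⨆ i, stanleySpace K (u i) (Z i) = monomialComplement K I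

/-- The Stanley depth of `S/I`: the maximum, over all Stanley decompositions `D` of `S/I`,
of the minimal dimension `|Z_i|` of a Stanley space occurring in `D`. -/
def sdepth (I : Ideal (MvPolynomial (Fin n) K)) : ℕ :=
  sSup {d : ℕ | ∃ D : StanleyDecomposition K I, ∀ i, d ≤ (D.Z i).card}


/-- The span of the monomials with exponents in `s`. -/
def monomialSpan (s : Set (Fin n →₀ ℕ)) : Submodule K (MvPolynomial (Fin n) K) :=
  Submodule.span K ((fun d => (monomial d (1 : K) : MvPolynomial (Fin n) K)) '' s)

/-- The exponents of the monomials in the Stanley space `u·K[Z]`. -/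
def stanleyBox (u : Fin n →₀ ℕ) (Z : Finset (Fin n)) : Set (Fin n →₀ ℕ) :=
  {d | u ≤ d ∧ ∀ i ∉ Z, d i = u i}

/-- The set `C` of exponents is a finite disjoint union of Stanley boxes of dimension at
least `d`. -/
def HasBoxPartition (C : Set (Fin n →₀ ℕ)) (d : ℕ) : Prop :=
  ∃ (ι : Type) (_ : Finite ι) (u : ι → (Fin n →₀ ℕ)) (Z : ι → Finset (Fin n)),
    Pairwise (Function.onFun Disjoint fun i => stanleyBox (u i) (Z i)) ∧
    ⋃ i, stanleyBox (u i) (Z i) = C ∧ ∀ i, d ≤ (Z i).card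

/-- The exponents divisible by no element of `B`. -/
def standardExponents (B : Set (Fin n →₀ ℕ)) : Set (Fin n →₀ ℕ) :=
  {d | ∀ b ∈ B, ¬ b ≤ d}

theorem linearIndependent_monomial_one :
    LinearIndependent K fun d : Fin n →₀ ℕ => (monomial d (1 : K) : MvPolynomial (Fin n) K) := by
  have h := (basisMonomials (Fin n) K).linearIndependent
  rwa [coe_basisMonomials] at h

theorem stanleySpace_eq_monomialSpan (u : Fin n →₀ ℕ) (Z : Finset (Fin n)) :
    stanleySpace K u Z = monomialSpan K (stanleyBox u Z) := by
  unfold stanleySpace monomialSpan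
  congr 1
  ext f
  constructor
  · rintro ⟨e, he, rfl⟩
    exact ⟨u + e, ⟨le_self_add, fun i hi => by simp [he i hi]⟩, rfl⟩
  · rintro ⟨d, ⟨hd, hdZ⟩, rfl⟩
    refine ⟨d - u, fun i hi => by simp [hdZ i hi], ?_⟩
    simp only [add_tsub_cancel_of_le hd]

theorem monomialSpan_injective : Function.Injective (monomialSpan K (n := n)) := by
  intro s t h
  ext d
  have key : ∀ s : Set (Fin n →₀ ℕ), monomial d (1 : K) ∈ monomialSpan K s ↔ d ∈ s := fun s =>
    ⟨fun hs => by_contra fun hd => (linearIndependent_monomial_one K).notMem_span_image hd hs,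
      fun hd => Submodule.subset_span ⟨d, hd, rfl⟩⟩
  rw [← key s, h, key t]

theorem iSup_monomialSpan {ι : Sort*} (s : ι → Set (Fin n →₀ ℕ)) :
    ⨆ i, monomialSpan K (s i) = monomialSpan K (⋃ i, s i) := by
  simp only [monomialSpan, Set.image_iUnion, Submodule.span_iUnion]

theorem disjoint_monomialSpan_iff {s t : Set (Fin n →₀ ℕ)} :
    Disjoint (monomialSpan K s) (monomialSpan K t) ↔ Disjoint s t := by
  refine ⟨fun h => ?_, fun h => (linearIndependent_monomial_one K).disjoint_span_image h⟩
  rw [Set.disjoint_left]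
  intro d hs ht
  have h0 := Submodule.disjoint_def.1 h _ (Submodule.subset_span ⟨d, hs, rfl⟩)
    (Submodule.subset_span ⟨d, ht, rfl⟩)
  simp at h0

theorem iSupIndep_monomialSpan_iff {ι : Type*} (s : ι → Set (Fin n →₀ ℕ)) :
    (iSupIndep fun i => monomialSpan K (s i)) ↔ Pairwise (Function.onFun Disjoint s) := by
  refine ⟨fun h i j hij => (disjoint_monomialSpan_iff K).1 (h.pairwiseDisjoint hij), fun h i => ?_⟩
  simp only [iSup_monomialSpan, disjoint_monomialSpan_iff, Set.disjoint_iUnion_right]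
  exact fun j hj => h hj.symm

theorem monomialComplement_span (B : Set (Fin n →₀ ℕ)) :
    monomialComplement K
        (Ideal.span ((fun d => (monomial d (1 : K) : MvPolynomial (Fin n) K)) '' B)) =
      monomialSpan K (standardExponents B) := by
  unfold monomialComplement monomialSpan
  congr 1
  ext f
  constructor
  · rintro ⟨d, rfl, hd⟩
    refine ⟨d, fun b hb hbd => hd ?_, rfl⟩
    rw [mem_ideal_span_monomial_image]
    intro e he
    obtain rfl : e = d := by simpa using support_monomial_subset he
    exact ⟨b, hb, hbd⟩
  · rintro ⟨d, hd, rfl⟩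
    refine ⟨d, rfl, fun h => ?_⟩
    rw [mem_ideal_span_monomial_image] at h
    obtain ⟨b, hb, hbd⟩ := h d (by simp)
    exact hd b hb hbd

theorem exists_stanleyDecomposition_iff (B : Set (Fin n →₀ ℕ)) (d : ℕ) :
    (∃ D : StanleyDecomposition K
        (Ideal.span ((fun d => (monomial d (1 : K) : MvPolynomial (Fin n) K)) '' B)),
      ∀ i, d ≤ (D.Z i).card) ↔ HasBoxPartition (standardExponents B) d := by
  constructor
  · rintro ⟨⟨r, u, Z, hind, hsup⟩, hd⟩
    simp only [stanleySpace_eq_monomialSpan] at hind hsup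
    rw [iSup_monomialSpan, monomialComplement_span] at hsup
    exact ⟨Fin r, inferInstance, u, Z, (iSupIndep_monomialSpan_iff K _).1 hind,
      monomialSpan_injective K hsup, hd⟩
  · rintro ⟨ι, _, u, Z, hdisj, hunion, hd⟩
    obtain ⟨r, ⟨e⟩⟩ := Finite.exists_equiv_fin ι
    refine ⟨⟨r, u ∘ e.symm, Z ∘ e.symm, ?_, ?_⟩, fun i => hd _⟩
    · simp only [stanleySpace_eq_monomialSpan, iSupIndep_monomialSpan_iff]
      exact fun i j hij => hdisj (e.symm.injective.ne hij)
    · simp only [stanleySpace_eq_monomialSpan, iSup_monomialSpan, monomialComplement_span,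
        Function.comp_apply, ← hunion]
      rw [e.symm.surjective.iUnion_comp fun i => stanleyBox (u i) (Z i)]

/-- Membership in a monomial ideal only depends on the exponents truncated at some bound. -/
theorem exists_truncation_bound (B : Set (Fin n →₀ ℕ)) :
    ∃ N : ℕ, ∀ d ∈ standardExponents {b ∈ B | ∀ i, b i ≤ N}, d ∈ standardExponents B := by
  have hfin : {b | Minimal (· ∈ B) b}.Finite :=
    (setOfPred_minimal_antichain _).finite_of_partiallyWellOrderedOn (Set.isPWO_of_wellQuasiOrderedLE _)
  obtain ⟨N, hN⟩ := (hfin.image fun b => Finset.univ.sup fun i => b i).bddAbove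
  refine ⟨N, fun d hd b hb hbd => ?_⟩
  obtain ⟨c, hcb, hc⟩ := exists_minimal_le_of_wellFoundedLT (· ∈ B) b hb
  exact hd c ⟨hc.1, fun i => (Finset.le_sup (Finset.mem_univ i)).trans (hN ⟨c, hc, rfl⟩)⟩
    (hcb.trans hbd)

theorem hasBoxPartition_standardExponents_zero (B : Set (Fin n →₀ ℕ)) :
    HasBoxPartition (standardExponents B) 0 := by
  obtain ⟨N, hN⟩ := exists_truncation_bound B
  let v : (Fin n → Fin (N + 1)) → (Fin n →₀ ℕ) := fun c => Finsupp.equivFunOnFinite.symm fun i => c i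
  have hv : ∀ c i, v c i = c i := fun c i => rfl
  let W : (Fin n → Fin (N + 1)) → Finset (Fin n) := fun c => {i | (c i : ℕ) = N}
  have hbox : ∀ c d, d ∈ stanleyBox (v c) (W c) ↔ ∀ i, (c i : ℕ) = min (d i) N := by
    intro c d
    constructor
    · rintro ⟨h1, h2⟩ i
      have h1i := h1 i
      have h2i := h2 i
      simp only [W, Finset.mem_filter, Finset.mem_univ, true_and, hv] at h1i h2i
      have := (c i).isLt
      by_cases h : (c i : ℕ) = N
      · omega
      · have := h2i h
        omega
    · intro h
      refine ⟨fun i => by rw [hv, h]; exact min_le_left _ _, fun i hi => ?_⟩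
      simp only [W, Finset.mem_filter, Finset.mem_univ, true_and] at hi
      have := h i
      rw [hv]
      omega
  refine ⟨{c // v c ∈ standardExponents B}, inferInstance, fun c => v c, fun c => W c, ?_, ?_,
    fun _ => Nat.zero_le _⟩
  · intro c c' hcc
    refine Set.disjoint_left.2 fun d h h' => hcc (Subtype.ext (funext fun i => Fin.ext ?_))
    rw [(hbox _ _).1 h i, (hbox _ _).1 h' i]
  · ext d
    simp only [Set.mem_iUnion, Subtype.exists]
    constructor
    · rintro ⟨c, hc, hd⟩
      refine hN d fun b hb hbd => hc b hb.1 fun i => ?_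
      rw [hv, (hbox _ _).1 hd i]
      exact le_min (hbd i) (hb.2 i)
    · intro hd
      have hc : ∀ i, min (d i) N < N + 1 := fun i => by omega
      refine ⟨fun i => ⟨min (d i) N, hc i⟩, fun b hb hbd => hd b hb fun i => ?_,
        (hbox _ _).2 fun i => rfl⟩
      exact (hbd i).trans (min_le_left _ _)

theorem HasBoxPartition.le_of_nonempty {C : Set (Fin n →₀ ℕ)} (hC : C.Nonempty) {d : ℕ}
    (h : HasBoxPartition C d) : d ≤ n := by
  obtain ⟨ι, _, u, Z, -, rfl, hd⟩ := h
  obtain ⟨i, -⟩ := Set.nonempty_iUnion.1 hC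
  exact (hd i).trans (by simpa using Finset.card_le_univ (Z i))

theorem mem_standardExponents_insert_single {B : Set (Fin n →₀ ℕ)} {k : Fin n}
    {d : Fin n →₀ ℕ} :
    d ∈ standardExponents (insert (Finsupp.single k 1) B) ↔ d k = 0 ∧ d ∈ standardExponents B := by
  simp only [standardExponents, Set.mem_ofPred_eq, Set.forall_mem_insert, Finsupp.single_le_iff]
  rw [Nat.not_le, Nat.lt_one_iff]

theorem erase_mem_standardExponents_iff {B : Set (Fin n →₀ ℕ)} {k : Fin n}
    (hB : ∀ b ∈ B, b k = 0) {d : Fin n →₀ ℕ} :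
    d.erase k ∈ standardExponents B ↔ d ∈ standardExponents B := by
  have key : ∀ b ∈ B, b ≤ d.erase k ↔ b ≤ d := by
    intro b hb
    constructor
    · intro h i
      refine (h i).trans ?_
      by_cases hi : i = k <;> simp [hi]
    · intro h i
      by_cases hi : i = k
      · simp [hi, hB b hb]
      · simpa [hi] using h i
  exact forall₂_congr fun b hb => not_congr (key b hb)

theorem erase_mem_stanleyBox_iff {u d : Fin n →₀ ℕ} {Z : Finset (Fin n)} {k : Fin n}
    (hu : u k = 0) :
    d.erase k ∈ stanleyBox u Z ↔ d ∈ stanleyBox u (insert k Z) := by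
  simp only [stanleyBox, Set.mem_ofPred_eq, Finsupp.le_def, ← forall_and]
  refine forall_congr' fun i => ?_
  by_cases hi : i = k
  · subst hi
    simp [hu]
  · simp [hi]

theorem mem_stanleyBox_erase_iff {u d : Fin n →₀ ℕ} {Z : Finset (Fin n)} {k : Fin n}
    (hu : u k = 0) :
    d ∈ stanleyBox u (Z.erase k) ↔ d k = 0 ∧ d ∈ stanleyBox u Z := by
  constructor
  · rintro ⟨h1, h2⟩
    exact ⟨by simpa [hu] using h2 k, h1, fun i hi => h2 i fun h => hi (Finset.mem_of_mem_erase h)⟩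
  · rintro ⟨h0, h1, h2⟩
    refine ⟨h1, fun i hi => ?_⟩
    by_cases hik : i = k
    · rw [hik, h0, hu]
    · exact h2 i fun h => hi (Finset.mem_erase.2 ⟨hik, h⟩)

theorem HasBoxPartition.insert_variable {B : Set (Fin n →₀ ℕ)} {k : Fin n}
    (hB : ∀ b ∈ B, b k = 0) {d : ℕ}
    (h : HasBoxPartition (standardExponents (insert (Finsupp.single k 1) B)) d) :
    HasBoxPartition (standardExponents B) (d + 1) := by
  obtain ⟨ι, hι, u, Z, hdisj, hunion, hd⟩ := h
  have hmem : ∀ {i e}, e ∈ stanleyBox (u i) (Z i) → e k = 0 := fun {i e} he =>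
    (mem_standardExponents_insert_single.1 (hunion ▸ Set.mem_iUnion_of_mem i he)).1
  have hu : ∀ i, u i k = 0 := fun i => hmem (i := i) ⟨le_rfl, fun _ _ => rfl⟩
  have hZ : ∀ i, k ∉ Z i := by
    intro i hk
    have : u i + Finsupp.single k 1 ∈ stanleyBox (u i) (Z i) :=
      ⟨le_self_add, fun j hj => by
        have : k ≠ j := fun h => hj (h ▸ hk)
        simp [Finsupp.single_eq_of_ne' this]⟩
    simpa using hmem this
  refine ⟨ι, hι, u, fun i => insert k (Z i), ?_, ?_, fun i => ?_⟩
  · intro i j hij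
    refine Set.disjoint_left.2 fun e he he' => ?_
    exact Set.disjoint_left.1 (hdisj hij) ((erase_mem_stanleyBox_iff (hu i)).2 he)
      ((erase_mem_stanleyBox_iff (hu j)).2 he')
  · ext e
    rw [← erase_mem_standardExponents_iff hB]
    have := (mem_standardExponents_insert_single (B := B) (d := e.erase k) (k := k))
    simp only [Finsupp.erase_same, true_and] at this
    rw [← this, ← hunion]
    simp only [Set.mem_iUnion, erase_mem_stanleyBox_iff (hu _)]
  · rw [Finset.card_insert_of_notMem (hZ i)]
    exact Nat.add_le_add_right (hd i) 1

theorem HasBoxPartition.erase_variable {B : Set (Fin n →₀ ℕ)} {k : Fin n} {d : ℕ}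
    (h : HasBoxPartition (standardExponents B) (d + 1)) :
    HasBoxPartition (standardExponents (insert (Finsupp.single k 1) B)) d := by
  obtain ⟨ι, hι, u, Z, hdisj, hunion, hd⟩ := h
  refine ⟨{i // u i k = 0}, inferInstance, fun i => u i, fun i => (Z i).erase k, ?_, ?_,
    fun i => ?_⟩
  · intro i j hij
    refine Set.disjoint_left.2 fun e he he' => ?_
    exact Set.disjoint_left.1 (hdisj (Subtype.coe_injective.ne hij))
      ((mem_stanleyBox_erase_iff i.2).1 he).2 ((mem_stanleyBox_erase_iff j.2).1 he').2
  · ext e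
    rw [mem_standardExponents_insert_single, ← hunion]
    simp only [Set.mem_iUnion, Subtype.exists]
    constructor
    · rintro ⟨i, hi, he⟩
      have := (mem_stanleyBox_erase_iff hi).1 he
      exact ⟨this.1, i, this.2⟩
    · rintro ⟨h0, i, he⟩
      have hi : u i k = 0 := Nat.le_zero.1 (h0 ▸ he.1 k)
      exact ⟨i, hi, (mem_stanleyBox_erase_iff hi).2 ⟨h0, he⟩⟩
  · have hcard := Finset.pred_card_le_card_erase (s := Z i) (a := k)
    exact (Nat.le_sub_one_of_lt (hd i)).trans hcard

theorem sdepth_span_insert_single {B : Set (Fin n →₀ ℕ)} {k : Fin n} (hB : ∀ b ∈ B, b k = 0)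
    (h0 : 0 ∉ B) :
    sdepth K (Ideal.span ((fun d => (monomial d (1 : K) : MvPolynomial (Fin n) K)) ''
        insert (Finsupp.single k 1) B)) + 1 =
      sdepth K (Ideal.span ((fun d => (monomial d (1 : K) : MvPolynomial (Fin n) K)) '' B)) := by
  simp only [sdepth, exists_stanleyDecomposition_iff]
  have hzero : (0 : Fin n →₀ ℕ) ∈ standardExponents B := fun b hb hb0 =>
    h0 (nonpos_iff_eq_zero.1 hb0 ▸ hb)
  have hzero' : (0 : Fin n →₀ ℕ) ∈ standardExponents (insert (Finsupp.single k 1) B) :=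
    mem_standardExponents_insert_single.2 ⟨rfl, hzero⟩
  have hbdd : BddAbove {d | HasBoxPartition (standardExponents B) d} :=
    ⟨n, fun d hd => hd.le_of_nonempty ⟨0, hzero⟩⟩
  have hbdd' : BddAbove
      {d | HasBoxPartition (standardExponents (insert (Finsupp.single k 1) B)) d} :=
    ⟨n, fun d hd => hd.le_of_nonempty ⟨0, hzero'⟩⟩
  refine le_antisymm (le_csSup hbdd ?_)
    (csSup_le ⟨0, hasBoxPartition_standardExponents_zero B⟩ fun d hd => ?_)
  · exact HasBoxPartition.insert_variable hB
      (Nat.sSup_mem ⟨0, hasBoxPartition_standardExponents_zero _⟩ hbdd')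
  · cases d with
    | zero => exact Nat.zero_le _
    | succ d => exact Nat.succ_le_succ (le_csSup hbdd' (HasBoxPartition.erase_variable hd))

theorem sdepth_sup_variable_of_extended {K : Type*} [Field K] {m n : ℕ} (hmn : m < n)
    (J : Ideal (MvPolynomial (Fin m) K)) (hJ : IsMonomialIdeal K J) (hJproper : J ≠ ⊤)
    (k : Fin n) (hk : m ≤ k.val) :
    sdepth K
        ((Ideal.map (rename (Fin.castLE hmn.le) : MvPolynomial (Fin m) K →ₐ[K] MvPolynomial (Fin n) K) J)
          ⊔ Ideal.span {(X k : MvPolynomial (Fin n) K)}) + 1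
      = sdepth K
          (Ideal.map (rename (Fin.castLE hmn.le) : MvPolynomial (Fin m) K →ₐ[K] MvPolynomial (Fin n) K) J) := by
  obtain ⟨A, rfl⟩ := hJ
  set B : Set (Fin n →₀ ℕ) := Finsupp.mapDomain (Fin.castLE hmn.le) '' A with hBdef
  have hmap : Ideal.map
      (rename (Fin.castLE hmn.le) : MvPolynomial (Fin m) K →ₐ[K] MvPolynomial (Fin n) K)
      (Ideal.span ((fun d => (monomial d (1 : K) : MvPolynomial (Fin m) K)) '' A)) =
      Ideal.span ((fun d => (monomial d (1 : K) : MvPolynomial (Fin n) K)) '' B) := by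
    rw [Ideal.map_span, hBdef, Set.image_image, Set.image_image]
    simp only [rename_monomial]
  have hB : ∀ b ∈ B, b k = 0 := by
    rintro _ ⟨a, -, rfl⟩
    refine Finsupp.mapDomain_of_notMem_range _ _ ?_
    rintro ⟨i, rfl⟩
    exact absurd i.isLt (not_lt.2 hk)
  have h0 : 0 ∉ B := by
    rintro ⟨a, ha, h⟩
    have ha0 : a = 0 :=
      Finsupp.mapDomain_injective (Fin.castLE_injective hmn.le) (h.trans Finsupp.mapDomain_zero.symm)
    subst ha0
    exact hJproper ((Ideal.eq_top_iff_one _).2 (Ideal.subset_span ⟨0, ha, rfl⟩))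
  rw [hmap, ← sdepth_span_insert_single K hB h0, Set.image_insert_eq, Ideal.span_insert, sup_comm]
  rfl

end
end
end

section
/- Let K be a field, m < n, J ⊂ S' = K[x_1,...,x_m] a monomial ideal, and S = K[x_1,...,x_n]. Then sdepth(S/JS) = sdepth(S'/J) + (n − m); in particular, extending a monomial ideal to a polynomial ring with one extra variable increases the Stanley depth of the quotient by exactly one. -/
/-!
STATEMENT 7: Let `K` be a field, `m < n`, `J ⊂ S' = K[x_1,…,x_m]` a monomial
ideal, and `S = K[x_1,…,x_n]`.  Then `sdepth(S/JS) = sdepth(S'/J) + (n − m)`.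
-/

open MvPolynomial

noncomputable section

variable (K : Type*) [Field K] {n : ℕ}
open MvPolynomial

noncomputable section

variable (K : Type*) [Field K] {n : ℕ}

/-- The exponents of the monomials in the Stanley space `u·K[Z]`. -/
def exponentBox (u : Fin n →₀ ℕ) (Z : Finset (Fin n)) : Set (Fin n →₀ ℕ) :=
  {d | u ≤ d ∧ ∀ i ∉ Z, d i = u i}

theorem stanleySpace_eq_restrictSupport (u : Fin n →₀ ℕ) (Z : Finset (Fin n)) :
    stanleySpace K u Z = restrictSupport K (exponentBox u Z) := by
  rw [restrictSupport_eq_span, stanleySpace]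
  congr 1
  ext f
  constructor
  · rintro ⟨e, he, rfl⟩
    exact ⟨u + e, ⟨le_self_add, fun i hi => by simp [he i hi]⟩, rfl⟩
  · rintro ⟨d, ⟨hud, hd⟩, rfl⟩
    refine ⟨d - u, fun i hi => by simp [hd i hi], ?_⟩
    simp only [add_tsub_cancel_of_le hud]

theorem monomialComplement_eq_restrictSupport (I : Ideal (MvPolynomial (Fin n) K)) :
    monomialComplement K I = restrictSupport K {d | monomial d (1 : K) ∉ I} := by
  rw [restrictSupport_eq_span, monomialComplement]
  congr 1
  ext f
  constructor
  · rintro ⟨d, rfl, hd⟩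
    exact ⟨d, hd, rfl⟩
  · rintro ⟨d, hd, rfl⟩
    exact ⟨d, rfl, hd⟩

theorem restrictSupport_iUnion {ι : Sort*} {σ : Type*} (s : ι → Set (σ →₀ ℕ)) :
    restrictSupport K (⋃ i, s i) = ⨆ i, restrictSupport K (s i) := by
  simp_rw [restrictSupport_eq_span, Set.image_iUnion, Submodule.span_iUnion]

theorem restrictSupport_injective {σ : Type*} :
    Function.Injective (restrictSupport K : Set (σ →₀ ℕ) → _) := by
  intro s t h
  ext d
  have := SetLike.ext_iff.1 h (monomial d 1)
  simpa using this

theorem disjoint_restrictSupport_iff {σ : Type*} {s t : Set (σ →₀ ℕ)} :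
    Disjoint (restrictSupport K s) (restrictSupport K t) ↔ Disjoint s t := by
  constructor
  · intro h
    rw [Set.disjoint_left]
    intro d hs ht
    have := Submodule.disjoint_def.1 h (monomial d 1) (by simp [hs]) (by simp [ht])
    simp at this
  · intro h
    rw [Submodule.disjoint_def]
    intro p hs ht
    rw [mem_restrictSupport_iff] at hs ht
    rw [← support_eq_empty, Finset.eq_empty_iff_forall_notMem]
    exact fun d hd => Set.disjoint_left.1 h (hs hd) (ht hd)

theorem iSupIndep_restrictSupport_iff {ι σ : Type*} {s : ι → Set (σ →₀ ℕ)} :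
    (iSupIndep fun i => restrictSupport K (s i)) ↔ ∀ i j d, d ∈ s i → d ∈ s j → i = j := by
  simp only [iSupIndep_def, ← restrictSupport_iUnion, disjoint_restrictSupport_iff,
    Set.disjoint_left, Set.mem_iUnion]
  refine forall_congr' fun i => ⟨fun h j d hi hj => ?_, ?_⟩
  · by_contra hij
    exact h hi ⟨j, Ne.symm hij, hj⟩
  · rintro h d hi ⟨j, hji, hj⟩
    exact hji (h j d hi hj).symm

/-- The boxes with corners `u i` and free directions `Z i` partition the set `C`. -/
def IsBoxPartition {ι : Type*} (C : Set (Fin n →₀ ℕ)) (u : ι → Fin n →₀ ℕ)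
    (Z : ι → Finset (Fin n)) : Prop :=
  (∀ i j d, d ∈ exponentBox (u i) (Z i) → d ∈ exponentBox (u j) (Z j) → i = j) ∧
    ∀ d, d ∈ C ↔ ∃ i, d ∈ exponentBox (u i) (Z i)

theorem StanleyDecomposition.isBoxPartition {K : Type*} [Field K] {n : ℕ}
    {I : Ideal (MvPolynomial (Fin n) K)} (D : StanleyDecomposition K I) :
    IsBoxPartition {d | monomial d (1 : K) ∉ I} D.u D.Z := by
  constructor
  · have := D.indep
    simp_rw [stanleySpace_eq_restrictSupport] at this
    exact (iSupIndep_restrictSupport_iff K).1 this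
  · have := D.sup_eq
    simp_rw [stanleySpace_eq_restrictSupport, ← restrictSupport_iUnion,
      monomialComplement_eq_restrictSupport] at this
    intro d
    rw [← restrictSupport_injective K this, Set.mem_iUnion]

theorem IsBoxPartition.exists_stanleyDecomposition {K : Type*} [Field K] {n : ℕ}
    {I : Ideal (MvPolynomial (Fin n) K)} {ι : Type*} [Finite ι] {u : ι → Fin n →₀ ℕ}
    {Z : ι → Finset (Fin n)} (h : IsBoxPartition {d | monomial d (1 : K) ∉ I} u Z)
    {k : ℕ} (hk : ∀ i, k ≤ (Z i).card) :
    ∃ D : StanleyDecomposition K I, ∀ i, k ≤ (D.Z i).card := by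
  have e := (Finite.equivFin ι).symm
  refine ⟨⟨Nat.card ι, u ∘ e, Z ∘ e, ?_, ?_⟩, fun i => hk _⟩
  · simp_rw [stanleySpace_eq_restrictSupport]
    rw [iSupIndep_restrictSupport_iff]
    exact fun i j d hi hj => e.injective (h.1 _ _ d hi hj)
  · simp_rw [stanleySpace_eq_restrictSupport, ← restrictSupport_iUnion,
      monomialComplement_eq_restrictSupport]
    congr 1
    ext d
    rw [h.2, Set.mem_iUnion]
    exact (e.surjective.exists (p := fun i => d ∈ exponentBox (u i) (Z i))).symm

theorem monomial_mem_span_iff (A : Set (Fin n →₀ ℕ)) (d : Fin n →₀ ℕ) :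
    (monomial d (1 : K)) ∈ Ideal.span ((fun d => (monomial d (1 : K))) '' A) ↔
      ∃ a ∈ A, a ≤ d := by
  classical
  simp [mem_ideal_span_monomial_image, support_monomial]

theorem exists_bound_of_exists_le (A : Set (Fin n →₀ ℕ)) :
    ∃ N : ℕ, ∀ d, (∃ a ∈ A, a ≤ d) → ∃ a ∈ A, a ≤ d ∧ ∀ i, a i ≤ N := by
  have hfin : {a | Minimal (· ∈ A) a}.Finite :=
    WellQuasiOrderedLE.finite_of_isAntichain (setOfPred_minimal_antichain _)
  obtain ⟨b, hb⟩ := hfin.bddAbove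
  refine ⟨Finset.univ.sup b, fun d ⟨a, ha, had⟩ => ?_⟩
  obtain ⟨c, hca, hc⟩ := exists_minimal_le_of_wellFoundedLT (· ∈ A) a ha
  exact ⟨c, hc.prop, hca.trans had,
    fun i => (hb hc i).trans (Finset.le_sup (f := b) (Finset.mem_univ i))⟩

theorem IsMonomialIdeal.exists_stanleyDecomposition {K : Type*} [Field K] {n : ℕ}
    {I : Ideal (MvPolynomial (Fin n) K)} (hI : IsMonomialIdeal K I) :
    Nonempty (StanleyDecomposition K I) := by
  obtain ⟨A, rfl⟩ := hI
  obtain ⟨N, hN⟩ := exists_bound_of_exists_le A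
  let T : Set (Fin n →₀ ℕ) := {c | (∀ i, c i ≤ N) ∧ ¬ ∃ a ∈ A, a ≤ c}
  have hT : Finite T := by
    refine Set.Finite.subset
      (Set.finite_Iic (Finsupp.equivFunOnFinite.symm fun _ : Fin n => N)) ?_
    exact fun c hc i => hc.1 i
  have key : IsBoxPartition {d | monomial d (1 : K) ∉
      Ideal.span ((fun d => (monomial d (1 : K))) '' A)}
      (fun c : T => (c : Fin n →₀ ℕ)) (fun c => Finset.univ.filter fun i => c.1 i = N) := by
    constructor
    · rintro ⟨c, hc⟩ ⟨c', hc'⟩ d ⟨hcd, h⟩ ⟨hcd', h'⟩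
      ext i
      have h1 := h i
      have h2 := h' i
      have h3 := hcd i
      have h4 := hcd' i
      have h5 := hc.1 i
      have h6 := hc'.1 i
      simp only [Finset.mem_filter, Finset.mem_univ, true_and] at h1 h2
      simp only at h3 h4 ⊢
      by_cases e1 : c i = N <;> by_cases e2 : c' i = N <;> grind
    · intro d
      simp only [Set.mem_ofPred_eq, monomial_mem_span_iff]
      constructor
      · intro hd
        refine ⟨⟨Finsupp.equivFunOnFinite.symm fun i => min (d i) N, fun i => by simp, ?_⟩, ?_, ?_⟩
        · rintro ⟨a, ha, had⟩
          exact hd ⟨a, ha, fun i => (had i).trans (by simp)⟩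
        · intro i
          simp
        · intro i hi
          simp at hi ⊢
          omega
      · rintro ⟨⟨c, hcN, hc⟩, hcd, h⟩ hd
        obtain ⟨a, ha, had, haN⟩ := hN d hd
        refine hc ⟨a, ha, fun i => ?_⟩
        by_cases hi : c i = N
        · exact hi ▸ haN i
        · exact (had i).trans (h i (by simpa using hi)).le
  obtain ⟨D, -⟩ := key.exists_stanleyDecomposition (k := 0) (by simp)
  exact ⟨D⟩

theorem embDomain_le_iff {m n : ℕ} (f : Fin m ↪ Fin n) (a : Fin m →₀ ℕ) (d : Fin n →₀ ℕ) :
    a.embDomain f ≤ d ↔ a ≤ d.comapDomain f f.injective.injOn := by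
  constructor
  · intro h i
    simpa using h (f i)
  · intro h j
    by_cases hj : j ∈ Set.range f
    · obtain ⟨i, rfl⟩ := hj
      simpa using h i
    · simp [Finsupp.embDomain_of_notMem_range _ _ _ hj]

theorem map_rename_span_monomial {m n : ℕ} (f : Fin m ↪ Fin n) (A : Set (Fin m →₀ ℕ)) :
    Ideal.map (rename f : MvPolynomial (Fin m) K →ₐ[K] MvPolynomial (Fin n) K)
        (Ideal.span ((fun d => monomial d (1 : K)) '' A)) =
      Ideal.span ((fun d => monomial d (1 : K)) '' (Finsupp.embDomain f '' A)) := by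
  rw [Ideal.map_span, Set.image_image, Set.image_image]
  simp [rename_monomial, Finsupp.embDomain_eq_mapDomain]

theorem IsMonomialIdeal.map_rename {K : Type*} [Field K] {m n : ℕ} (f : Fin m ↪ Fin n)
    {J : Ideal (MvPolynomial (Fin m) K)} (hJ : IsMonomialIdeal K J) :
    IsMonomialIdeal K
      (Ideal.map (rename f : MvPolynomial (Fin m) K →ₐ[K] MvPolynomial (Fin n) K) J) := by
  obtain ⟨A, rfl⟩ := hJ
  exact ⟨_, map_rename_span_monomial K f A⟩

theorem IsMonomialIdeal.monomial_mem_map_rename_iff {K : Type*} [Field K] {m n : ℕ}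
    (f : Fin m ↪ Fin n) {J : Ideal (MvPolynomial (Fin m) K)} (hJ : IsMonomialIdeal K J)
    (d : Fin n →₀ ℕ) :
    monomial d (1 : K) ∈
        Ideal.map (rename f : MvPolynomial (Fin m) K →ₐ[K] MvPolynomial (Fin n) K) J ↔
      monomial (d.comapDomain f f.injective.injOn) (1 : K) ∈ J := by
  obtain ⟨A, rfl⟩ := hJ
  rw [map_rename_span_monomial, monomial_mem_span_iff, monomial_mem_span_iff]
  simp [embDomain_le_iff]

theorem mem_exponentBox_embDomain_iff {m n : ℕ} (f : Fin m ↪ Fin n) (u : Fin m →₀ ℕ)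
    (Z : Finset (Fin m)) (d : Fin n →₀ ℕ) :
    d ∈ exponentBox (u.embDomain f) (Zᶜ.map f)ᶜ ↔
      d.comapDomain f f.injective.injOn ∈ exponentBox u Z := by
  simp [exponentBox, embDomain_le_iff]

theorem embDomain_mem_exponentBox_iff {m n : ℕ} (f : Fin m ↪ Fin n) (u : Fin n →₀ ℕ)
    (Z : Finset (Fin n)) (d : Fin m →₀ ℕ) :
    d.embDomain f ∈ exponentBox u Z ↔
      (∀ j ∉ Set.range f, u j = 0) ∧
        d ∈ exponentBox (u.comapDomain f f.injective.injOn)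
          (Finset.univ.filter fun i => f i ∈ Z) := by
  constructor
  · rintro ⟨hle, h⟩
    refine ⟨fun j hj => ?_, fun i => by simpa using hle (f i), fun i hi => ?_⟩
    · have := hle j
      rw [Finsupp.embDomain_of_notMem_range _ _ _ hj] at this
      omega
    · simpa using h (f i) (by simpa using hi)
  · rintro ⟨h0, hle, h⟩
    refine ⟨fun j => ?_, fun j hj => ?_⟩ <;> by_cases hjf : j ∈ Set.range f
    · obtain ⟨i, rfl⟩ := hjf
      simpa using hle i
    · simp [h0 j hjf]
    · obtain ⟨i, rfl⟩ := hjf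
      simpa using h i (by simpa using hj)
    · rw [Finsupp.embDomain_of_notMem_range _ _ _ hjf, h0 j hjf]

theorem StanleyDecomposition.exists_map_rename {K : Type*} [Field K] {m n : ℕ}
    (f : Fin m ↪ Fin n) {J : Ideal (MvPolynomial (Fin m) K)} (hJ : IsMonomialIdeal K J)
    (D : StanleyDecomposition K J) {k : ℕ} (hk : ∀ i, k ≤ (D.Z i).card) :
    ∃ D' : StanleyDecomposition K
        (Ideal.map (rename f : MvPolynomial (Fin m) K →ₐ[K] MvPolynomial (Fin n) K) J),
      ∀ i, k + (n - m) ≤ (D'.Z i).card := by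
  have hD := D.isBoxPartition
  refine IsBoxPartition.exists_stanleyDecomposition
    (u := fun i => (D.u i).embDomain f) (Z := fun i => ((D.Z i)ᶜ.map f)ᶜ) ⟨?_, ?_⟩ fun i => ?_
  · intro i j d hi hj
    rw [mem_exponentBox_embDomain_iff] at hi hj
    exact hD.1 i j _ hi hj
  · intro d
    simp_rw [mem_exponentBox_embDomain_iff, ← hD.2]
    exact (hJ.monomial_mem_map_rename_iff f d).not
  · have h1 := hk i
    have h2 : (D.Z i).card ≤ m := by simpa using (D.Z i).card_le_univ
    have h3 : m ≤ n := by simpa using Fintype.card_le_of_embedding f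
    simp only [Finset.card_compl, Finset.card_map, Fintype.card_fin]
    omega

theorem StanleyDecomposition.exists_of_map_rename {K : Type*} [Field K] {m n : ℕ}
    (f : Fin m ↪ Fin n) {J : Ideal (MvPolynomial (Fin m) K)} (hJ : IsMonomialIdeal K J)
    (D : StanleyDecomposition K
      (Ideal.map (rename f : MvPolynomial (Fin m) K →ₐ[K] MvPolynomial (Fin n) K) J))
    {k : ℕ} (hk : ∀ i, k ≤ (D.Z i).card) :
    ∃ D' : StanleyDecomposition K J, ∀ i, k - (n - m) ≤ (D'.Z i).card := by
  have hD := D.isBoxPartition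
  refine IsBoxPartition.exists_stanleyDecomposition
    (ι := {i // ∀ j ∉ Set.range f, D.u i j = 0})
    (u := fun i => (D.u i).comapDomain f f.injective.injOn)
    (Z := fun i => Finset.univ.filter fun l => f l ∈ D.Z i) ⟨?_, ?_⟩ fun i => ?_
  · intro i j d hi hj
    exact Subtype.ext (hD.1 i j (d.embDomain f)
      ((embDomain_mem_exponentBox_iff f _ _ d).2 ⟨i.2, hi⟩)
      ((embDomain_mem_exponentBox_iff f _ _ d).2 ⟨j.2, hj⟩))
  · intro d
    have h1 := hD.2 (d.embDomain f)
    have h2 : (d.embDomain f).comapDomain f f.injective.injOn = d := by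
      ext i
      simp
    rw [Set.mem_ofPred_eq, hJ.monomial_mem_map_rename_iff f, h2] at h1
    rw [Set.mem_ofPred_eq, h1]
    simp only [embDomain_mem_exponentBox_iff, Subtype.exists]
    exact exists_congr fun i => exists_prop.symm
  · have h1 := hk i
    have h2 : ((Finset.univ.filter fun l => f l ∈ D.Z i)ᶜ.map f).card ≤ (D.Z i)ᶜ.card := by
      refine Finset.card_le_card fun j hj => ?_
      obtain ⟨l, hl, rfl⟩ := Finset.mem_map.1 hj
      simpa using hl
    have h3 : m ≤ n := by simpa using Fintype.card_le_of_embedding f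
    have h4 : (D.Z i).card ≤ n := by simpa using (D.Z i).card_le_univ
    simp only [Finset.card_compl, Finset.card_map, Fintype.card_fin] at h2
    omega

theorem StanleyDecomposition.bddAbove {K : Type*} [Field K] {n : ℕ}
    {I : Ideal (MvPolynomial (Fin n) K)} (hI : I ≠ ⊤) :
    BddAbove {k : ℕ | ∃ D : StanleyDecomposition K I, ∀ i, k ≤ (D.Z i).card} := by
  refine ⟨n, ?_⟩
  rintro k ⟨D, hk⟩
  obtain ⟨i, -⟩ := (D.isBoxPartition.2 0).1 fun h => hI ((Ideal.eq_top_iff_one I).2 h)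
  exact (hk i).trans (by simpa using (D.Z i).card_le_univ)

theorem sdepth_extend {K : Type*} [Field K] {m n : ℕ} (hmn : m < n)
    (J : Ideal (MvPolynomial (Fin m) K)) (hJ : IsMonomialIdeal K J) (hJproper : J ≠ ⊤) :
    sdepth K
        (Ideal.map (rename (Fin.castLE hmn.le) : MvPolynomial (Fin m) K →ₐ[K] MvPolynomial (Fin n) K) J)
      = sdepth K J + (n - m) := by
  let f : Fin m ↪ Fin n := Fin.castLEEmb hmn.le
  have hA := StanleyDecomposition.bddAbove hJproper
  obtain ⟨D₀⟩ := hJ.exists_stanleyDecomposition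
  have hA₀ : {k : ℕ | ∃ D : StanleyDecomposition K J, ∀ i, k ≤ (D.Z i).card}.Nonempty :=
    ⟨0, D₀, by simp⟩
  obtain ⟨D₁⟩ := (hJ.map_rename f).exists_stanleyDecomposition
  apply le_antisymm
  · refine csSup_le ⟨0, D₁, by simp⟩ ?_
    rintro k ⟨D, hk⟩
    have := le_csSup hA (StanleyDecomposition.exists_of_map_rename f hJ D hk)
    exact tsub_le_iff_right.1 this
  · obtain ⟨D, hD⟩ := Nat.sSup_mem hA₀ hA
    refine le_csSup ⟨sdepth K J + (n - m), ?_⟩ (D.exists_map_rename f hJ hD)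
    rintro k ⟨D', hk⟩
    have := le_csSup hA (StanleyDecomposition.exists_of_map_rename f hJ D' hk)
    exact tsub_le_iff_right.1 this

end
end
end
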